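/- arXiv:2309.00114 — 11 statements merged into one kernel-verified Lean document; each statement's English description precedes it below -/
import Mathlib

section
/- Fix N ≥ 2 and constants c₃, …, c_N ∈ ℝ. Let u : ℝ → ℝ be weakly increasing with u(0) = 0 and let w : ℝ × ℝ → ℝ be nonnegative, and define V and u⁰ as in the weighted separable attribute model. Then the following are equivalent: (a) Assumption A1 (Injective) holds; (b) for all x₁ > 0 and y₂ > 0, setting x = (x₁, 0, c₃, …, c_N) and y = (0, y₂, c₃, …, c_N), one has V(x|{x,y}) = V(y|{y,x}) if and only if x₁ = y₂. -/
/-- Proposition 1 (m-MPL, general N with constant extra attributes): for a weighted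
separable attribute model with N ≥ 2 attributes and constants c in attributes 3,…,N,
Assumption A1 (Injective) is equivalent to the statement that for alternatives
x = (x₁, 0, c₃, …, c_N) and y = (0, y₂, c₃, …, c_N) with x₁, y₂ > 0,
indifference holds iff x₁ = y₂. -/
theorem mMPL_accurate_many_attributes
    (N : ℕ) (hN : 2 ≤ N) (c : Fin N → ℝ)
    (u : ℝ → ℝ) (w : ℝ → ℝ → ℝ)
    (hu : Monotone u) (hu0 : u 0 = 0) (hw : ∀ t s : ℝ, 0 ≤ w t s) :
    (∀ t s : ℝ, 0 < s → s < t → u t * w t 0 ≠ u s * w s 0) ↔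
      (∀ x₁ y₂ : ℝ, 0 < x₁ → 0 < y₂ →
        ((∑ i : Fin N,
            u (if i.val = 0 then x₁ else if i.val = 1 then 0 else c i) *
              w (if i.val = 0 then x₁ else if i.val = 1 then 0 else c i)
                (if i.val = 0 then 0 else if i.val = 1 then y₂ else c i)) =
         (∑ i : Fin N,
            u (if i.val = 0 then 0 else if i.val = 1 then y₂ else c i) *
              w (if i.val = 0 then 0 else if i.val = 1 then y₂ else c i)
                (if i.val = 0 then x₁ else if i.val = 1 then 0 else c i)) ↔
          x₁ = y₂)) := by
  obtain ⟨M, rfl⟩ := Nat.exists_eq_add_of_le' hN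
  simp only [Fin.sum_univ_succ, Fin.val_zero, Fin.val_succ, Nat.add_eq_zero_iff, one_ne_zero,
    and_false, if_true, if_false, hu0, zero_mul, zero_add, Nat.add_eq_right, add_left_inj]
  constructor
  · intro h x y hx hy
    refine ⟨fun he => ?_, fun he => he ▸ rfl⟩
    rcases lt_trichotomy x y with hlt | heq | hgt
    · exact absurd he.symm (h y x hx hlt)
    · exact heq
    · exact absurd he (h x y hy hgt)
  · intro h t s hs hst he
    exact hst.ne' ((h t s (hs.trans hst) hs).1 he)
end

section
/- Let u : ℝ → ℝ be weakly increasing with u(0) = 0 and let w : ℝ × ℝ → ℝ be nonnegative, and define V and u⁰ as in the weighted separable attribute model with N = 2 attributes. Then the following are equivalent: (a) Assumptions A1 (Injective) and A2 (Symmetry) both hold; (b) for all x₁, x₂ ∈ ℝ with x₁·x₂ < 0, setting x = (x₁, x₂) and y = (0, 0), one has V(x|{x,y}) = V(y|{y,x}) if and only if x₁ = −x₂. -/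
/-- A function `f` is injective on the positive reals and odd iff, for numbers of opposite sign,
`f a + f b = 0` holds exactly when `a = -b`. -/
lemma injective_and_odd_iff_add_eq_zero_iff (f : ℝ → ℝ) :
    ((∀ t s : ℝ, 0 < s → s < t → f t ≠ f s) ∧ (∀ t : ℝ, 0 < t → f t = -f (-t))) ↔
      (∀ a b : ℝ, a * b < 0 → (f a + f b = 0 ↔ a = -b)) := by
  constructor
  · rintro ⟨hinj, hodd⟩
    have key : ∀ a b : ℝ, 0 < a → b < 0 → (f a + f b = 0 ↔ a = -b) := by
      intro a b ha hb
      have hb' := hodd (-b) (by linarith)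
      rw [neg_neg] at hb'
      constructor
      · intro h
        rcases lt_trichotomy a (-b) with hlt | heq | hgt
        · exact absurd (by linarith) (hinj (-b) a ha hlt)
        · exact heq
        · exact absurd (by linarith) (hinj a (-b) (by linarith) hgt)
      · rintro rfl
        linarith
    intro a b hab
    rcases mul_neg_iff.mp hab with ⟨ha, hb⟩ | ⟨ha, hb⟩
    · exact key a b ha hb
    · rw [add_comm, key b a hb ha, eq_comm, neg_eq_iff_eq_neg]
  · intro h
    have hodd : ∀ t : ℝ, 0 < t → f t = -f (-t) := fun t ht =>
      eq_neg_of_add_eq_zero_left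
        ((h t (-t) (mul_neg_of_pos_of_neg ht (by linarith))).mpr (neg_neg t).symm)
    refine ⟨fun t s hs hst hf => ?_, hodd⟩
    have hts := (h t (-s) (mul_neg_of_pos_of_neg (by linarith) (by linarith))).mp
      (by linarith [hodd s hs])
    linarith

/-- Proposition 2 (p-MPL ignore scenario, N = 2): for a weighted separable attribute
model, Assumptions A1 (Injective) and A2 (Symmetry) together are equivalent to the
statement that for alternatives x = (x₁, x₂) with x₁·x₂ < 0 and y = (0, 0),
indifference V(x|{x,y}) = V(y|{y,x}) holds iff x₁ = −x₂. -/
theorem pMPL_ignore_accurate_two_attributes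
    (u : ℝ → ℝ) (w : ℝ → ℝ → ℝ)
    (hu : Monotone u) (hu0 : u 0 = 0) (hw : ∀ t s : ℝ, 0 ≤ w t s) :
    ((∀ t s : ℝ, 0 < s → s < t → u t * w t 0 ≠ u s * w s 0) ∧
      (∀ t : ℝ, 0 < t → u t * w t 0 = -(u (-t) * w (-t) 0))) ↔
      (∀ x₁ x₂ : ℝ, x₁ * x₂ < 0 →
        (u x₁ * w x₁ 0 + u x₂ * w x₂ 0 = u 0 * w 0 x₁ + u 0 * w 0 x₂ ↔ x₁ = -x₂)) := by
  simpa only [hu0, zero_mul, add_zero] using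
    injective_and_odd_iff_add_eq_zero_iff (fun t => u t * w t 0)
end

section
/- Fix N ≥ 2 and constants c₃, …, c_N ∈ ℝ. Let u : ℝ → ℝ be weakly increasing with u(0) = 0 and let w : ℝ × ℝ → ℝ be nonnegative, and define V and u⁰ as in the weighted separable attribute model. Then the following are equivalent: (a) Assumptions A1 (Injective) and A2 (Symmetry) both hold; (b) for all x₁, x₂ ∈ ℝ with x₁·x₂ < 0, setting x = (x₁, x₂, c₃, …, c_N) and y = (0, 0, c₃, …, c_N), one has V(x|{x,y}) = V(y|{y,x}) if and only if x₁ = −x₂. -/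
/-- Common attributes cancel, and attributes at the reference value `0` contribute nothing, so
indifference only involves the first two attributes. -/
theorem sum_eq_sum_iff_first_two_cancel {N : ℕ} (hN : 2 ≤ N) (c : Fin N → ℝ)
    (u : ℝ → ℝ) (w : ℝ → ℝ → ℝ) (hu0 : u 0 = 0) (x₁ x₂ : ℝ) :
    (∑ i : Fin N,
        u (if i.val = 0 then x₁ else if i.val = 1 then x₂ else c i) *
          w (if i.val = 0 then x₁ else if i.val = 1 then x₂ else c i)
            (if i.val = 0 then 0 else if i.val = 1 then 0 else c i)) =
      (∑ i : Fin N,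
        u (if i.val = 0 then 0 else if i.val = 1 then 0 else c i) *
          w (if i.val = 0 then 0 else if i.val = 1 then 0 else c i)
            (if i.val = 0 then x₁ else if i.val = 1 then x₂ else c i)) ↔
      u x₁ * w x₁ 0 + u x₂ * w x₂ 0 = 0 := by
  obtain ⟨M, rfl⟩ := Nat.exists_eq_add_of_le' hN
  simp [Fin.sum_univ_succ, hu0, ← add_assoc]

/-- Proposition 2 (p-MPL ignore/separate scenario, general N with constant extra
attributes): for a weighted separable attribute model with N ≥ 2 attributes and
constants c in attributes 3,…,N, Assumptions A1 (Injective) and A2 (Symmetry)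
together are equivalent to the statement that for alternatives
x = (x₁, x₂, c₃, …, c_N) with x₁·x₂ < 0 and y = (0, 0, c₃, …, c_N),
indifference holds iff x₁ = −x₂. -/
theorem pMPL_ignore_accurate_many_attributes
    (N : ℕ) (hN : 2 ≤ N) (c : Fin N → ℝ)
    (u : ℝ → ℝ) (w : ℝ → ℝ → ℝ)
    (hu : Monotone u) (hu0 : u 0 = 0) (hw : ∀ t s : ℝ, 0 ≤ w t s) :
    ((∀ t s : ℝ, 0 < s → s < t → u t * w t 0 ≠ u s * w s 0) ∧
      (∀ t : ℝ, 0 < t → u t * w t 0 = -(u (-t) * w (-t) 0))) ↔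
      (∀ x₁ x₂ : ℝ, x₁ * x₂ < 0 →
        ((∑ i : Fin N,
            u (if i.val = 0 then x₁ else if i.val = 1 then x₂ else c i) *
              w (if i.val = 0 then x₁ else if i.val = 1 then x₂ else c i)
                (if i.val = 0 then 0 else if i.val = 1 then 0 else c i)) =
         (∑ i : Fin N,
            u (if i.val = 0 then 0 else if i.val = 1 then 0 else c i) *
              w (if i.val = 0 then 0 else if i.val = 1 then 0 else c i)
                (if i.val = 0 then x₁ else if i.val = 1 then x₂ else c i)) ↔
          x₁ = -x₂)) := by
  simp only [sum_eq_sum_iff_first_two_cancel hN c u w hu0]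
  constructor
  · rintro ⟨hinj, hsymm⟩ x₁ x₂ hx
    have pos_inj : ∀ a b : ℝ, 0 < a → 0 < b → u a * w a 0 = u b * w b 0 → a = b := by
      intro a b ha hb hab
      rcases lt_trichotomy a b with h | h | h
      · exact absurd hab.symm (hinj b a ha h)
      · exact h
      · exact absurd hab (hinj a b hb h)
    rcases mul_neg_iff.mp hx with ⟨h₁, h₂⟩ | ⟨h₁, h₂⟩
    · have hs := hsymm (-x₂) (by linarith)
      rw [neg_neg] at hs
      constructor
      · intro h
        exact pos_inj x₁ (-x₂) h₁ (by linarith) (by linarith)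
      · rintro rfl
        linarith
    · have hs := hsymm (-x₁) (by linarith)
      rw [neg_neg] at hs
      constructor
      · intro h
        linarith [pos_inj (-x₁) x₂ (by linarith) h₂ (by linarith)]
      · intro h
        obtain rfl : x₂ = -x₁ := by linarith
        linarith
  · intro h
    have hsymm : ∀ t : ℝ, 0 < t → u t * w t 0 = -(u (-t) * w (-t) 0) := fun t ht =>
      eq_neg_of_add_eq_zero_left ((h t (-t) (by nlinarith)).mpr (neg_neg t).symm)
    refine ⟨fun t s hs hst heq => ?_, hsymm⟩
    have hts := (h t (-s) (by nlinarith)).mp (by linarith [hsymm s hs])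
    linarith
end

section
/- Let u : ℝ → ℝ be weakly increasing with u(0) = 0 and let w : ℝ × ℝ → ℝ be nonnegative, and define V and u⁰ as in the weighted separable attribute model with N = 2 attributes. Then the following are equivalent: (a) Assumptions A1 (Injective) and A3 (Linearity) both hold; (b) for all x₁, x₂, y₂ ∈ ℝ with x₁ > 0, x₂ > 0 and y₂ > x₂, setting x = (x₁, x₂) and y = (0, y₂), one has V(x|{x,y}) = V(y|{y,x}) if and only if x₁ + x₂ = y₂. -/
/-- Proposition 3 (p-MPL combine scenario, N = 2): for a weighted separable attribute
model, Assumptions A1 (Injective) and A3 (Linearity) together are equivalent to the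
statement that for alternatives x = (x₁, x₂) and y = (0, y₂) with
x₁, x₂ > 0 and y₂ > x₂, indifference V(x|{x,y}) = V(y|{y,x}) holds iff x₁ + x₂ = y₂. -/
theorem pMPL_combine_accurate_two_attributes
    (u : ℝ → ℝ) (w : ℝ → ℝ → ℝ)
    (hu : Monotone u) (hu0 : u 0 = 0) (hw : ∀ t s : ℝ, 0 ≤ w t s) :
    ((∀ t s : ℝ, 0 < s → s < t → u t * w t 0 ≠ u s * w s 0) ∧
      (∀ t s : ℝ, 0 < s → s < t →
        u (t - s) * w (t - s) 0 = u t * w t s - u s * w s t)) ↔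
      (∀ x₁ x₂ y₂ : ℝ, 0 < x₁ → 0 < x₂ → x₂ < y₂ →
        (u x₁ * w x₁ 0 + u x₂ * w x₂ y₂ = u 0 * w 0 x₁ + u y₂ * w y₂ x₂ ↔
          x₁ + x₂ = y₂)) := by
  simp only [hu0, zero_mul, zero_add]
  constructor
  · rintro ⟨hinj, hlin⟩ x₁ x₂ y₂ hx₁ hx₂ hy
    have h := hlin y₂ x₂ hx₂ hy
    constructor
    · intro he
      rcases lt_trichotomy x₁ (y₂ - x₂) with hlt | heq | hgt
      · exact absurd (by linarith) (hinj (y₂ - x₂) x₁ hx₁ hlt)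
      · linarith
      · exact absurd (by linarith) (hinj x₁ (y₂ - x₂) (sub_pos.mpr hy) hgt)
    · intro he
      rw [← eq_sub_iff_add_eq] at he
      rw [he]
      linarith
  · intro h
    refine ⟨fun t s hs hst he => ?_, fun t s hs hst => ?_⟩
    · have h₁ := (h s 1 (s + 1) hs one_pos (by linarith)).mpr rfl
      have h₂ := (h t 1 (s + 1) (hs.trans hst) one_pos (by linarith)).mp (by linarith)
      linarith
    · have h₁ := (h (t - s) s t (sub_pos.mpr hst) hs hst).mpr (by ring)
      linarith
end

section
/- Fix N ≥ 2 and constants c₃, …, c_N ∈ ℝ. Let u : ℝ → ℝ be weakly increasing with u(0) = 0 and let w : ℝ × ℝ → ℝ be nonnegative, and define V and u⁰ as in the weighted separable attribute model. Then the following are equivalent: (a) Assumptions A1 (Injective) and A3 (Linearity) both hold; (b) for all x₁, x₂, y₂ ∈ ℝ with x₁ > 0, x₂ > 0 and y₂ > x₂, setting x = (x₁, x₂, c₃, …, c_N) and y = (0, y₂, c₃, …, c_N), one has V(x|{x,y}) = V(y|{y,x}) if and only if x₁ + x₂ = y₂. -/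
/-- Two sums over `Fin N` whose summands agree from the third index on are equal if and only if
the sums of their first two terms are. -/
theorem sum_eq_sum_iff_of_eq_tail {N : ℕ} (hN : 2 ≤ N) {f g : Fin N → ℝ}
    (h : ∀ i : Fin N, i.val ≠ 0 → i.val ≠ 1 → f i = g i) :
    ∑ i, f i = ∑ i, g i ↔
      f ⟨0, by omega⟩ + f ⟨1, by omega⟩ = g ⟨0, by omega⟩ + g ⟨1, by omega⟩ := by
  obtain ⟨k, rfl⟩ := Nat.exists_eq_add_of_le' hN
  have tail : ∑ i : Fin k, f i.succ.succ = ∑ i : Fin k, g i.succ.succ :=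
    Finset.sum_congr rfl fun i _ => h _ (by simp) (by simp)
  rw [Fin.sum_univ_succ, Fin.sum_univ_succ, Fin.sum_univ_succ g, Fin.sum_univ_succ, tail,
    ← add_assoc, ← add_assoc, add_left_inj]
  rfl


/-- Proposition 3 (p-MPL combine scenario, general N with constant extra attributes):
for a weighted separable attribute model with N ≥ 2 attributes and constants c in
attributes 3,…,N, Assumptions A1 (Injective) and A3 (Linearity) together are
equivalent to the statement that for alternatives x = (x₁, x₂, c₃, …, c_N) and
y = (0, y₂, c₃, …, c_N) with x₁, x₂ > 0 and y₂ > x₂, indifference holds iff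
x₁ + x₂ = y₂. -/
theorem pMPL_combine_accurate_many_attributes
    (N : ℕ) (hN : 2 ≤ N) (c : Fin N → ℝ)
    (u : ℝ → ℝ) (w : ℝ → ℝ → ℝ)
    (hu : Monotone u) (hu0 : u 0 = 0) (hw : ∀ t s : ℝ, 0 ≤ w t s) :
    ((∀ t s : ℝ, 0 < s → s < t → u t * w t 0 ≠ u s * w s 0) ∧
      (∀ t s : ℝ, 0 < s → s < t →
        u (t - s) * w (t - s) 0 = u t * w t s - u s * w s t)) ↔
      (∀ x₁ x₂ y₂ : ℝ, 0 < x₁ → 0 < x₂ → x₂ < y₂ →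
        ((∑ i : Fin N,
            u (if i.val = 0 then x₁ else if i.val = 1 then x₂ else c i) *
              w (if i.val = 0 then x₁ else if i.val = 1 then x₂ else c i)
                (if i.val = 0 then 0 else if i.val = 1 then y₂ else c i)) =
         (∑ i : Fin N,
            u (if i.val = 0 then 0 else if i.val = 1 then y₂ else c i) *
              w (if i.val = 0 then 0 else if i.val = 1 then y₂ else c i)
                (if i.val = 0 then x₁ else if i.val = 1 then x₂ else c i)) ↔
          x₁ + x₂ = y₂)) := by
  have indiff_iff (x₁ x₂ y₂ : ℝ) := sum_eq_sum_iff_of_eq_tail hN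
    (f := fun i => u (if i.val = 0 then x₁ else if i.val = 1 then x₂ else c i) *
      w (if i.val = 0 then x₁ else if i.val = 1 then x₂ else c i)
        (if i.val = 0 then 0 else if i.val = 1 then y₂ else c i))
    (g := fun i => u (if i.val = 0 then 0 else if i.val = 1 then y₂ else c i) *
      w (if i.val = 0 then 0 else if i.val = 1 then y₂ else c i)
        (if i.val = 0 then x₁ else if i.val = 1 then x₂ else c i))
    (fun i h0 h1 => by simp [h0, h1])
  simp only [indiff_iff, if_true, one_ne_zero, if_false, hu0, zero_mul, zero_add]
  constructor
  · rintro ⟨inj, lin⟩ x₁ x₂ y₂ h₁ h₂ h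
    have hlin := lin y₂ x₂ h₂ h
    constructor
    · intro heq
      rcases lt_trichotomy x₁ (y₂ - x₂) with hlt | hx | hlt
      · exact absurd (by linarith) (inj _ _ h₁ hlt)
      · linarith
      · exact absurd (by linarith) (inj _ _ (sub_pos.mpr h) hlt)
    · intro hx
      rw [eq_sub_of_add_eq hx]
      linarith
  · intro hiff
    have lin : ∀ t s : ℝ, 0 < s → s < t →
        u (t - s) * w (t - s) 0 = u t * w t s - u s * w s t := fun t s hs hst =>
      eq_sub_of_add_eq ((hiff (t - s) s t (sub_pos.mpr hst) hs hst).mpr (sub_add_cancel t s))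
    refine ⟨fun t s hs hst heq => ?_, lin⟩
    have hlin := lin (t + 1) 1 one_pos (by linarith)
    rw [add_sub_cancel_right] at hlin
    have := (hiff s 1 (t + 1) hs one_pos (by linarith)).mp (by linarith)
    linarith
end

section
/- Let v : ℝ × ℝ → ℝ define a separable attribute model with N = 2 attributes. Then the following are equivalent: (a) Assumptions B1 (Injective) and B2 (Symmetry) both hold; (b) for all x₁, x₂ ∈ ℝ with x₁·x₂ < 0, setting x = (x₁, x₂) and y = (0, 0), one has V(x|{x,y}) = V(y|{y,x}) if and only if x₁ = −x₂. -/
/-- Theorem 2 (p-MPL ignore scenario, separable attribute model, N = 2):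
Assumptions B1 (Injective) and B2 (Symmetry) together are equivalent to the
statement that for alternatives x = (x₁, x₂) with x₁·x₂ < 0 and y = (0, 0),
indifference V(x|{x,y}) = V(y|{y,x}) holds iff x₁ = −x₂. -/
theorem pMPL_ignore_accurate_separable
    (v : ℝ → ℝ → ℝ)
    (hv0 : ∀ t : ℝ, v 0 t = 0)
    (hpos : ∀ t : ℝ, 0 < t → 0 ≤ v t 0)
    (hneg : ∀ t : ℝ, t < 0 → v t 0 ≤ 0) :
    ((∀ t s : ℝ, 0 < s → s < t → v t 0 ≠ v s 0) ∧
      (∀ t : ℝ, 0 < t → v t 0 = -(v (-t) 0))) ↔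
      (∀ x₁ x₂ : ℝ, x₁ * x₂ < 0 →
        (v x₁ 0 + v x₂ 0 = v 0 x₁ + v 0 x₂ ↔ x₁ = -x₂)) := by
  simp only [hv0, add_zero]
  constructor
  · rintro ⟨hinj, hsymm⟩ x₁ x₂ hx
    have eq_of_eq : ∀ a b : ℝ, 0 < a → 0 < b → v a 0 = v b 0 → a = b := by
      intro a b ha hb h
      rcases lt_trichotomy a b with hab | hab | hab
      · exact absurd h.symm (hinj b a ha hab)
      · exact hab
      · exact absurd h (hinj a b hb hab)
    rcases mul_neg_iff.mp hx with ⟨h₁, h₂⟩ | ⟨h₁, h₂⟩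
    · have hs := hsymm (-x₂) (by linarith)
      rw [neg_neg] at hs
      constructor
      · intro h
        exact eq_of_eq x₁ (-x₂) h₁ (by linarith) (by linarith)
      · rintro rfl
        linarith
    · have hs := hsymm (-x₁) (by linarith)
      rw [neg_neg] at hs
      constructor
      · intro h
        have := eq_of_eq x₂ (-x₁) h₂ (by linarith) (by linarith)
        linarith
      · intro h
        obtain rfl : x₂ = -x₁ := by linarith
        linarith
  · intro h
    have hsymm : ∀ t : ℝ, 0 < t → v t 0 = -(v (-t) 0) := by
      intro t ht
      have := (h t (-t) (by nlinarith)).mpr (neg_neg t).symm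
      linarith
    refine ⟨fun t s hs hst heq => ?_, hsymm⟩
    have hsum : v t 0 + v (-s) 0 = 0 := by linarith [hsymm s hs]
    have := (h t (-s) (by nlinarith)).mp hsum
    linarith
end

section
/- Let v : ℝ × ℝ → ℝ define a separable attribute model with N = 2 attributes. Then the following are equivalent: (a) Assumptions B1 (Injective) and B3 (Linearity) both hold; (b) for all x₁, x₂, y₂ ∈ ℝ with x₁ > 0, x₂ > 0 and y₂ > x₂, setting x = (x₁, x₂) and y = (0, y₂), one has V(x|{x,y}) = V(y|{y,x}) if and only if x₁ + x₂ = y₂. -/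
/-- Theorem 3 (p-MPL combine scenario, separable attribute model, N = 2):
Assumptions B1 (Injective) and B3 (Linearity) together are equivalent to the
statement that for alternatives x = (x₁, x₂) and y = (0, y₂) with x₁, x₂ > 0 and
y₂ > x₂, indifference V(x|{x,y}) = V(y|{y,x}) holds iff x₁ + x₂ = y₂. -/
theorem pMPL_combine_accurate_separable
    (v : ℝ → ℝ → ℝ)
    (hv0 : ∀ t : ℝ, v 0 t = 0)
    (hpos : ∀ t : ℝ, 0 < t → 0 ≤ v t 0)
    (hneg : ∀ t : ℝ, t < 0 → v t 0 ≤ 0) :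
    ((∀ t s : ℝ, 0 < s → s < t → v t 0 ≠ v s 0) ∧
      (∀ t s : ℝ, 0 < s → s < t → v (t - s) 0 = v t s - v s t)) ↔
      (∀ x₁ x₂ y₂ : ℝ, 0 < x₁ → 0 < x₂ → x₂ < y₂ →
        (v x₁ 0 + v x₂ y₂ = v 0 x₁ + v y₂ x₂ ↔ x₁ + x₂ = y₂)) := by
  constructor
  · rintro ⟨hinj, hlin⟩ x₁ x₂ y₂ hx₁ hx₂ hxy
    have hl := hlin y₂ x₂ hx₂ hxy
    rw [hv0]
    constructor
    · intro h
      have heq : v x₁ 0 = v (y₂ - x₂) 0 := by linarith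
      rcases lt_trichotomy x₁ (y₂ - x₂) with hlt | he | hgt
      · exact absurd heq.symm (hinj _ _ hx₁ hlt)
      · linarith
      · exact absurd heq (hinj _ _ (sub_pos.mpr hxy) hgt)
    · intro h
      obtain rfl : x₁ = y₂ - x₂ := by linarith
      linarith
  · intro H
    refine ⟨fun t s hs hst heq => ?_, fun t s hs hst => ?_⟩
    · have h := (H t 1 (t + 1) (hs.trans hst) one_pos (by linarith)).2 rfl
      rw [hv0 t, heq] at h
      have := (H s 1 (t + 1) hs one_pos (by linarith)).1 (by rw [hv0 s, h])
      linarith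
    · have h := (H (t - s) s t (sub_pos.mpr hst) hs hst).2 (sub_add_cancel t s)
      rw [hv0] at h
      linarith
end

section
/- Let α > 0 with α ≠ 1, γ > −1, and let 0 < p < E and q > 0. If q^{α(1+γ)} + (E − p)^α·(E^α − (E − p)^α)^γ = E^α·(E^α − (E − p)^α)^γ, then q = (E^α − (E − p)^α)^{1/α}. Moreover, if 0 < α < 1 then q < p, and if α > 1 then q > p. -/
/-- Strict superadditivity of `x ↦ x ^ r` on the positive reals for `r > 1`. -/
theorem rpow_add_rpow_lt_add_rpow {a b r : ℝ} (ha : 0 < a) (hb : 0 < b) (hr : 1 < r) :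
    a ^ r + b ^ r < (a + b) ^ r := by
  have split : ∀ x : ℝ, 0 < x → x ^ r = x * x ^ (r - 1) := fun x hx => by
    rw [← Real.rpow_one_add' hx.le (by linarith)]; congr 1; ring
  have hr' : 0 < r - 1 := by linarith
  have h₁ : a ^ (r - 1) < (a + b) ^ (r - 1) :=
    Real.rpow_lt_rpow ha.le (by linarith) hr'
  have h₂ : b ^ (r - 1) < (a + b) ^ (r - 1) :=
    Real.rpow_lt_rpow hb.le (by linarith) hr'
  rw [split a ha, split b hb, split (a + b) (by linarith), add_mul]
  gcongr

/-- Strict subadditivity of `x ↦ x ^ r` on the positive reals for `r < 1`. -/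
theorem add_rpow_lt_rpow_add_rpow {a b r : ℝ} (ha : 0 < a) (hb : 0 < b) (hr : r < 1) :
    (a + b) ^ r < a ^ r + b ^ r := by
  have split : ∀ x : ℝ, 0 < x → x ^ r = x * x ^ (r - 1) := fun x hx => by
    rw [Real.rpow_sub_one hx.ne']; field_simp
  have hr' : r - 1 < 0 := by linarith
  have h₁ : (a + b) ^ (r - 1) < a ^ (r - 1) :=
    Real.rpow_lt_rpow_of_neg ha (by linarith) hr'
  have h₂ : (a + b) ^ (r - 1) < b ^ (r - 1) :=
    Real.rpow_lt_rpow_of_neg hb (by linarith) hr'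
  rw [split a ha, split b hb, split (a + b) (by linarith), add_mul]
  gcongr

/-- Example 2 (range normalization with power utility, p-MPL combine scenario):
if q^(α(1+γ)) + (E−p)^α·(E^α − (E−p)^α)^γ = E^α·(E^α − (E−p)^α)^γ with
α > 0, α ≠ 1, γ > −1, 0 < p < E, q > 0, then q = (E^α − (E−p)^α)^(1/α);
moreover q < p when α < 1 and q > p when α > 1. -/
theorem RN_power_pMPL_combine_misestimates
    (α γ E p q : ℝ) (hα : 0 < α) (hα1 : α ≠ 1) (hγ : -1 < γ)
    (hp : 0 < p) (hpE : p < E) (hq : 0 < q)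
    (heq : q ^ (α * (1 + γ)) + (E - p) ^ α * (E ^ α - (E - p) ^ α) ^ γ
         = E ^ α * (E ^ α - (E - p) ^ α) ^ γ) :
    q = (E ^ α - (E - p) ^ α) ^ (1 / α) ∧
    (α < 1 → q < p) ∧ (1 < α → p < q) := by
  have hEp : 0 < E - p := by linarith
  have hD : 0 < E ^ α - (E - p) ^ α :=
    sub_pos.2 (Real.rpow_lt_rpow hEp.le (by linarith) hα)
  have hqD : q ^ α = E ^ α - (E - p) ^ α := by
    refine (Real.rpow_left_inj (Real.rpow_nonneg hq.le α) hD.le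
      (by linarith : 0 < 1 + γ).ne').1 ?_
    rw [← Real.rpow_mul hq.le, Real.rpow_add hD, Real.rpow_one]
    linarith
  refine ⟨?_, fun h => ?_, fun h => ?_⟩
  · rw [← hqD, one_div, Real.rpow_rpow_inv hq.le hα.ne']
  · have key := add_rpow_lt_rpow_add_rpow hp hEp h
    rw [add_sub_cancel] at key
    exact (Real.rpow_lt_rpow_iff hq.le hp.le hα).1 (by linarith)
  · have key := rpow_add_rpow_lt_add_rpow hp hEp h
    rw [add_sub_cancel] at key
    exact (Real.rpow_lt_rpow_iff hp.le hq.le hα).1 (by linarith)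
end

section
/- Let σ > 0, let 0 < p < E, and let q > 0. If q/(σ + q) + (E − p)/(σ + (E − p) + E) = E/(σ + E + (E − p)), then q = σ·p/(σ + 2E − 2p), and consequently q < p. -/
/-- Example 3 (generalized pairwise normalization, p-MPL combine scenario):
if q/(σ+q) + (E−p)/(σ+(E−p)+E) = E/(σ+E+(E−p)) with σ > 0, 0 < p < E, q > 0,
then q = σp/(σ+2E−2p), and consequently q < p. -/
theorem GPN_pMPL_combine_underestimates
    (σ E p q : ℝ) (hσ : 0 < σ) (hp : 0 < p) (hpE : p < E) (hq : 0 < q)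
    (heq : q / (σ + q) + (E - p) / (σ + (E - p) + E) = E / (σ + E + (E - p))) :
    q = σ * p / (σ + 2 * E - 2 * p) ∧ q < p := by
  have hD : 0 < σ + 2 * E - 2 * p := by linarith
  have hqp : q / (σ + q) = p / (σ + E + (E - p)) := by
    rw [add_right_comm σ (E - p) E] at heq
    rw [eq_sub_of_add_eq heq, ← sub_div, sub_sub_cancel]
  rw [div_eq_div_iff (by linarith) (by linarith)] at hqp
  have hmul : q * (σ + 2 * E - 2 * p) = σ * p := by linear_combination hqp
  refine ⟨eq_div_of_mul_eq hD.ne' hmul, lt_of_mul_lt_mul_right ?_ hD.le⟩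
  rw [hmul, mul_comm σ p]
  exact mul_lt_mul_of_pos_left (by linarith) hp
end

section
/- Let θ ∈ (0,1) and define v : ℝ × ℝ → ℝ by v(t,s) = u_CC(t,s)·|t − s|^{1−θ}, where u_CC(t,s) = (t − min(t,s))^θ when t ≥ 0 and s ≥ 0, and u_CC(t,s) = −(|t| − max(t,s))^θ when t ≤ 0 and s ≤ 0 (the normalized contextual concavity model). Then v⁰(t) := v(t,0) = t for all t ∈ ℝ, and the model satisfies Assumption B1 (Injective: for all t > s > 0, v⁰(t) ≠ v⁰(s)), Assumption B2 (Symmetry: for every t > 0, v⁰(t) = −v⁰(−t)), and Assumption B3 (Linearity: for all t > s > 0, v⁰(t − s) = v(t,s) − v(s,t)). -/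
theorem rpow_mul_rpow_one_sub {a : ℝ} (ha : 0 ≤ a) (θ : ℝ) : a ^ θ * a ^ (1 - θ) = a := by
  rw [← Real.rpow_add' ha (by simp), add_sub_cancel, Real.rpow_one]

/-- Example 4 (normalized contextual concavity model): with θ ∈ (0,1),
v(t,s) = u_CC(t,s)·|t − s|^(1−θ) where u_CC(t,s) = (t − min(t,s))^θ for t,s ≥ 0 and
u_CC(t,s) = −(|t| − max(t,s))^θ for t,s ≤ 0, one has v⁰(t) = t for all t, and the
model satisfies Assumption B1 (Injective), B2 (Symmetry), and B3 (Linearity). -/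
theorem NCC_satisfies_B1_B2_B3
    (θ : ℝ) (hθ : θ ∈ Set.Ioo (0 : ℝ) 1)
    (uCC : ℝ → ℝ → ℝ)
    (h1 : ∀ t s : ℝ, 0 ≤ t → 0 ≤ s → uCC t s = (t - min t s) ^ θ)
    (h2 : ∀ t s : ℝ, t ≤ 0 → s ≤ 0 → uCC t s = -((|t| - max t s) ^ θ))
    (v : ℝ → ℝ → ℝ)
    (hv : ∀ t s : ℝ, v t s = uCC t s * |t - s| ^ (1 - θ)) :
    (∀ t : ℝ, v t 0 = t) ∧
    (∀ t s : ℝ, 0 < s → s < t → v t 0 ≠ v s 0) ∧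
    (∀ t : ℝ, 0 < t → v t 0 = -(v (-t) 0)) ∧
    (∀ t s : ℝ, 0 < s → s < t → v (t - s) 0 = v t s - v s t) := by
  have of_le (t s : ℝ) (hs : 0 ≤ s) (hst : s ≤ t) : v t s = t - s := by
    rw [hv, h1 t s (hs.trans hst) hs, min_eq_right hst, abs_of_nonneg (sub_nonneg.2 hst),
      rpow_mul_rpow_one_sub (sub_nonneg.2 hst)]
  have of_ge (t s : ℝ) (ht : 0 ≤ t) (hts : t ≤ s) : v t s = 0 := by
    rw [hv, h1 t s ht (ht.trans hts), min_eq_left hts, sub_self, Real.zero_rpow hθ.1.ne', zero_mul]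
  have at_zero (t : ℝ) : v t 0 = t := by
    rcases le_total 0 t with ht | ht
    · rw [of_le t 0 le_rfl ht, sub_zero]
    · rw [hv, h2 t 0 ht le_rfl, max_eq_right ht, sub_zero, sub_zero, neg_mul,
        rpow_mul_rpow_one_sub (abs_nonneg t), abs_of_nonpos ht, neg_neg]
  refine ⟨at_zero, fun t s _ hst => ?_, fun t _ => ?_, fun t s hs hst => ?_⟩
  · rw [at_zero, at_zero]
    exact hst.ne'
  · rw [at_zero, at_zero, neg_neg]
  · rw [at_zero, of_le t s hs.le hst.le, of_ge s t hs.le hst.le, sub_zero]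
end

section
/- Let γ > −1, and let u(t) = t for all t ∈ ℝ and w(t,s) = |t − s|^γ when t ≠ s, w(t,s) = 0 when t = s, with u⁰(t) = u(t)·w(t,0) (the range normalization model with linear utility). Then the model satisfies Assumption A1 (Injective: for all t > s > 0, u⁰(t) ≠ u⁰(s)), Assumption A2 (Symmetry: for every t > 0, u⁰(t) = −u⁰(−t)), and Assumption A3 (Linearity: for all t > s > 0, u⁰(t − s) = u(t)·w(t,s) − u(s)·w(s,t)). -/
/-- The range normalization model with linear utility (u(t) = t,
w(t,s) = |t−s|^γ for t ≠ s and 0 otherwise, γ > −1, u⁰(t) = u(t)·w(t,0))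
satisfies Assumption A1 (Injective), A2 (Symmetry), and A3 (Linearity). -/
theorem RN_linear_satisfies_A1_A2_A3
    (γ : ℝ) (hγ : -1 < γ)
    (u : ℝ → ℝ) (hu : ∀ t : ℝ, u t = t)
    (w : ℝ → ℝ → ℝ)
    (hw : ∀ t s : ℝ, w t s = if t = s then 0 else |t - s| ^ γ)
    (u0 : ℝ → ℝ) (hu0 : ∀ t : ℝ, u0 t = u t * w t 0) :
    (∀ t s : ℝ, 0 < s → s < t → u0 t ≠ u0 s) ∧
    (∀ t : ℝ, 0 < t → u0 t = -u0 (-t)) ∧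
    (∀ t s : ℝ, 0 < s → s < t → u0 (t - s) = u t * w t s - u s * w s t) := by
  have u0_of_pos : ∀ t : ℝ, 0 < t → u0 t = t * t ^ γ := fun t ht => by
    rw [hu0, hu, hw, if_neg ht.ne', sub_zero, abs_of_pos ht]
  refine ⟨fun t s hs hst => ?_, fun t ht => ?_, fun t s hs hst => ?_⟩
  · have ht : 0 < t := hs.trans hst
    rw [u0_of_pos t ht, u0_of_pos s hs, ← Real.rpow_one_add' ht.le (by linarith),
      ← Real.rpow_one_add' hs.le (by linarith)]
    exact (Real.rpow_lt_rpow hs.le hst (by linarith)).ne'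
  · rw [u0_of_pos t ht, hu0, hu, hw, if_neg (neg_ne_zero.mpr ht.ne'), sub_zero, abs_neg,
      abs_of_pos ht]
    ring
  · rw [u0_of_pos _ (sub_pos.mpr hst), hu, hu, hw, hw, if_neg hst.ne', if_neg hst.ne,
      abs_sub_comm s t, abs_of_pos (sub_pos.mpr hst)]
    ring
end
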